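/- arXiv:2501.11387 — 3 statements merged into one kernel-verified Lean document; each statement's English description precedes it below -/
import Mathlib

section
/- Let (Ω, d_Ω) be a compact metric space endowed with a probability measure ν, and suppose that for each N ∈ ℕ* a tagged partition of size N with constants C_Ω > 0, γ > 0 is given. Assume the Lipschitz-in-z condition (LipZ) on σ and f, and that y⁰ is continuous on Ω. Let T″ ∈ (0,T], let y be a solution of the integral evolution equation on [0,T″] with initial datum y⁰ (so y(t) ∈ B for all t ∈ [0,T″]), and suppose that for every N ≥ N₀ the associated particle system has a solution on [0,T″] with y^N(t) ∈ B for all t ∈ [0,T″]. Then for every t ∈ [0,T″] the function x ↦ y(t,x) is continuous on Ω, and y^N(t,x) → y(t,x) as N → +∞, uniformly with respect to (t,x) ∈ [0,T″] × Ω; in particular ξ_i^N(t) − y(t, x_i^N) → 0 uniformly in t and i. -/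
open MeasureTheory

noncomputable section

/-- The piecewise-constant function on `Ω` built from a partition `Ωi` and values `ξ`. -/
def pc {Ω : Type*} {E : Type*} [AddCommMonoid E] {N : ℕ}
    (Ωi : Fin N → Set Ω) (ξ : Fin N → E) : Ω → E :=
  fun x => ∑ i, (Ωi i).indicator (fun _ => ξ i) x

/-- The (pointwise) sup distance between two functions, modelling the `L^∞` distance. -/
def supDist {Ω : Type*} {E : Type*} [NormedAddCommGroup E] (z₁ z₂ : Ω → E) : ℝ :=
  ⨆ x, ‖z₁ x - z₂ x‖

theorem pc_eq_of_mem {Ω : Type*} {E : Type*} [AddCommMonoid E] {N : ℕ}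
    (Ωi : Fin N → Set Ω) (ξ : Fin N → E)
    (hdisj : ∀ i j, i ≠ j → Disjoint (Ωi i) (Ωi j)) {i : Fin N} {x : Ω} (hx : x ∈ Ωi i) :
    pc Ωi ξ x = ξ i := by
  unfold pc
  rw [Finset.sum_eq_single i]
  · simp [hx]
  · intro j _ hj
    exact Set.indicator_of_notMem (fun h => Set.disjoint_left.1 (hdisj j i hj) h hx) _
  · intro h
    exact absurd (Finset.mem_univ i) h

theorem integrable_pc {Ω : Type*} [MeasurableSpace Ω] (ν : Measure Ω) [IsProbabilityMeasure ν]
    {E : Type*} [NormedAddCommGroup E] [NormedSpace ℝ E] {N : ℕ}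
    (Ωi : Fin N → Set Ω) (a : Fin N → E) (hmeas : ∀ i, MeasurableSet (Ωi i)) :
    Integrable (pc Ωi a) ν := by
  unfold pc
  exact integrable_finsetSum _ (fun i _ => (integrable_const (a i)).indicator (hmeas i))

theorem integral_pc {Ω : Type*} [MeasurableSpace Ω] (ν : Measure Ω) [IsProbabilityMeasure ν]
    {E : Type*} [NormedAddCommGroup E] [NormedSpace ℝ E] [CompleteSpace E] {N : ℕ}
    (Ωi : Fin N → Set Ω) (a : Fin N → E) (hmeas : ∀ i, MeasurableSet (Ωi i))
    (hvol : ∀ i, ν (Ωi i) = 1 / N) :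
    ∫ x, pc Ωi a x ∂ν = (N : ℝ)⁻¹ • ∑ j, a j := by
  unfold pc
  rw [integral_finsetSum _ (fun i _ => (integrable_const (a i)).indicator (hmeas i)),
    Finset.smul_sum]
  refine Finset.sum_congr rfl (fun i _ => ?_)
  rw [integral_indicator_const _ (hmeas i), Measure.real, hvol i]
  simp

/-- on a compact metric space, under the Lipschitz-in-`z` condition and for a
continuous initial datum, the solution `y(t,·)` is continuous in `x` and the particle
approximations `y^N` converge to `y` uniformly on `[0,T''] × Ω`; in particular
`ξ_i^N(t) − y(t, x_i^N) → 0` uniformly in `t` and `i`. -/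
theorem stmt1
    {Ω : Type*} [MetricSpace Ω] [CompactSpace Ω] [MeasurableSpace Ω] [BorelSpace Ω]
    (ν : Measure Ω) [IsProbabilityMeasure ν]
    {d : ℕ} (hd : 0 < d)
    (CΩ γ : ℝ) (hCΩ : 0 < CΩ) (hγ : 0 < γ)
    -- the family of tagged partitions
    (Ωi : (N : ℕ) → Fin N → Set Ω) (xi : (N : ℕ) → Fin N → Ω)
    (hmeas : ∀ N, 1 ≤ N → ∀ i, MeasurableSet (Ωi N i))
    (hdisj : ∀ N, 1 ≤ N → ∀ i j, i ≠ j → Disjoint (Ωi N i) (Ωi N j))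
    (hcover : ∀ N, 1 ≤ N → (⋃ i, Ωi N i) = Set.univ)
    (hvol : ∀ N, 1 ≤ N → ∀ i, ν (Ωi N i) = 1 / N)
    (hdiam : ∀ N, 1 ≤ N → ∀ i, Metric.diam (Ωi N i) ≤ CΩ / (N : ℝ) ^ γ)
    (htag : ∀ N, 1 ≤ N → ∀ i, xi N i ∈ Ωi N i)
    -- the data of the integral evolution equation
    (T : ℝ) (hT : 0 < T)
    (y0 : Ω → EuclideanSpace ℝ (Fin d)) (r : ℝ) (hr : 0 < r)
    (σ : ℝ → (Ω → EuclideanSpace ℝ (Fin d)) → Ω → Ω →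
      (EuclideanSpace ℝ (Fin d) →L[ℝ] EuclideanSpace ℝ (Fin d)))
    (f : ℝ → (Ω → EuclideanSpace ℝ (Fin d)) → Ω → EuclideanSpace ℝ (Fin d))
    (Cσ Cf Lσ Lf : ℝ) (hLσ : 0 ≤ Lσ) (hLf : 0 ≤ Lf)
    -- boundedness of σ and f on the ball B
    (hσbd : ∀ t ∈ Set.Icc (0 : ℝ) T, ∀ z, (∀ x, ‖z x - y0 x‖ ≤ r) →
      ∀ x x', ‖σ t z x x'‖ ≤ Cσ)
    (hfbd : ∀ t ∈ Set.Icc (0 : ℝ) T, ∀ z, (∀ x, ‖z x - y0 x‖ ≤ r) →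
      ∀ x, ‖f t z x‖ ≤ Cf)
    -- the Lipschitz-in-z condition (LipZ)
    (hσlipz : ∀ t ∈ Set.Icc (0 : ℝ) T, ∀ z₁ z₂, (∀ x, ‖z₁ x - y0 x‖ ≤ r) →
      (∀ x, ‖z₂ x - y0 x‖ ≤ r) → ∀ x x',
      ‖σ t z₁ x x' - σ t z₂ x x'‖ ≤ Lσ * supDist z₁ z₂)
    (hflipz : ∀ t ∈ Set.Icc (0 : ℝ) T, ∀ z₁ z₂, (∀ x, ‖z₁ x - y0 x‖ ≤ r) →
      (∀ x, ‖z₂ x - y0 x‖ ≤ r) → ∀ x,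
      ‖f t z₁ x - f t z₂ x‖ ≤ Lf * supDist z₁ z₂)
    -- continuity of σ and f in the space variables, uniformly in (t,z)
    (hσcont : ∀ δ > (0 : ℝ), ∃ ρ > (0 : ℝ), ∀ t ∈ Set.Icc (0 : ℝ) T, ∀ z,
      (∀ x, ‖z x - y0 x‖ ≤ r) → ∀ x₁ x₂ x₁' x₂', dist x₁ x₂ ≤ ρ → dist x₁' x₂' ≤ ρ →
      ‖σ t z x₁ x₁' - σ t z x₂ x₂'‖ ≤ δ)
    (hfcont : ∀ δ > (0 : ℝ), ∃ ρ > (0 : ℝ), ∀ t ∈ Set.Icc (0 : ℝ) T, ∀ z,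
      (∀ x, ‖z x - y0 x‖ ≤ r) → ∀ x₁ x₂, dist x₁ x₂ ≤ ρ →
      ‖f t z x₁ - f t z x₂‖ ≤ δ)
    -- the initial datum is continuous
    (hy0cont : Continuous y0)
    -- the solution y of the integral evolution equation on [0,T'']
    (T'' : ℝ) (hT''0 : 0 < T'') (hT''T : T'' ≤ T)
    (y : ℝ → Ω → EuclideanSpace ℝ (Fin d))
    (hymeas : ∀ t ∈ Set.Icc (0 : ℝ) T'', AEStronglyMeasurable (y t) ν)
    (hyB : ∀ t ∈ Set.Icc (0 : ℝ) T'', ∀ x, ‖y t x - y0 x‖ ≤ r)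
    (hyinit : y 0 = y0)
    (hyode : ∀ x, ∀ t ∈ Set.Icc (0 : ℝ) T'',
      HasDerivWithinAt (fun s => y s x)
        ((∫ x', (σ t (y t) x x') (y t x') ∂ν) + f t (y t) x)
        (Set.Icc 0 T'') t)
    -- the particle solutions for N ≥ N₀
    (N₀ : ℕ) (hN₀ : 1 ≤ N₀)
    (ξ : (N : ℕ) → ℝ → Fin N → EuclideanSpace ℝ (Fin d))
    (hξinit : ∀ N, N₀ ≤ N → ∀ i, ξ N 0 i = y0 (xi N i))
    (hξB : ∀ N, N₀ ≤ N → ∀ t ∈ Set.Icc (0 : ℝ) T'', ∀ x,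
      ‖pc (Ωi N) (ξ N t) x - y0 x‖ ≤ r)
    (hξode : ∀ N, N₀ ≤ N → ∀ i, ∀ t ∈ Set.Icc (0 : ℝ) T'',
      HasDerivWithinAt (fun s => ξ N s i)
        ((N : ℝ)⁻¹ • ∑ j, (σ t (pc (Ωi N) (ξ N t)) (xi N i) (xi N j)) (ξ N t j)
          + f t (pc (Ωi N) (ξ N t)) (xi N i))
        (Set.Icc 0 T'') t) :
    (∀ t ∈ Set.Icc (0 : ℝ) T'', Continuous (y t)) ∧
    (∀ δ > (0 : ℝ), ∃ N₁ : ℕ, N₀ ≤ N₁ ∧ ∀ N, N₁ ≤ N →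
      ∀ t ∈ Set.Icc (0 : ℝ) T'', ∀ x,
        ‖pc (Ωi N) (ξ N t) x - y t x‖ ≤ δ) ∧
    (∀ δ > (0 : ℝ), ∃ N₁ : ℕ, N₀ ≤ N₁ ∧ ∀ N, N₁ ≤ N →
      ∀ t ∈ Set.Icc (0 : ℝ) T'', ∀ i : Fin N,
        ‖ξ N t i - y t (xi N i)‖ ≤ δ) := by
  classical
  obtain ⟨x₀⟩ : Nonempty Ω := by
    by_contra h
    rw [not_nonempty_iff] at h
    have h1 : ν Set.univ = 1 := measure_univ
    rw [Set.univ_eq_empty_iff.2 h] at h1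
    simp at h1
  have : Nonempty Ω := ⟨x₀⟩
  obtain ⟨M0, hM0⟩ : ∃ M0 : ℝ, ∀ x, ‖y0 x‖ ≤ M0 := by
    obtain ⟨C, hC⟩ := isCompact_univ.exists_bound_of_continuousOn hy0cont.continuousOn
    exact ⟨C, fun x => hC x (Set.mem_univ x)⟩
  have hM00 : 0 ≤ M0 := (norm_nonneg _).trans (hM0 x₀)
  obtain ⟨M, hMdef⟩ : ∃ M, M = M0 + r := ⟨_, rfl⟩
  have hM : 0 ≤ M := by linarith
  have hball : ∀ z : Ω → EuclideanSpace ℝ (Fin d), (∀ x, ‖z x - y0 x‖ ≤ r) →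
      ∀ x, ‖z x‖ ≤ M := by
    intro z hz x
    have h1 : ‖z x‖ ≤ ‖z x - y0 x‖ + ‖y0 x‖ := by
      simpa using norm_add_le (z x - y0 x) (y0 x)
    have := hz x
    have := hM0 x
    linarith
  have hsub : ∀ t ∈ Set.Icc (0 : ℝ) T'', t ∈ Set.Icc (0 : ℝ) T :=
    fun t ht => ⟨ht.1, ht.2.trans hT''T⟩
  have h0mem : (0 : ℝ) ∈ Set.Icc (0 : ℝ) T'' := ⟨le_rfl, hT''0.le⟩
  have hCσ : 0 ≤ Cσ :=
    (norm_nonneg _).trans (hσbd 0 (hsub 0 h0mem) (y 0) (hyB 0 h0mem) x₀ x₀)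
  have hσc : ∀ t ∈ Set.Icc (0 : ℝ) T'', ∀ x, Continuous (fun x' => σ t (y t) x x') := by
    intro t ht x
    rw [Metric.continuous_iff]
    intro b ε hε
    obtain ⟨ρ, hρ, h⟩ := hσcont (ε / 2) (by linarith)
    refine ⟨ρ, hρ, fun a ha => ?_⟩
    rw [dist_eq_norm]
    have := h t (hsub t ht) (y t) (hyB t ht) x x a b (by simpa using hρ.le) ha.le
    linarith
  have hintegr : ∀ t ∈ Set.Icc (0 : ℝ) T'', ∀ x,
      Integrable (fun x' => (σ t (y t) x x') (y t x')) ν := by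
    intro t ht x
    refine Integrable.of_bound (C := Cσ * M) ?_ (Filter.Eventually.of_forall fun x' => ?_)
    · exact (isBoundedBilinearMap_apply (𝕜 := ℝ) (E := EuclideanSpace ℝ (Fin d))
        (F := EuclideanSpace ℝ (Fin d))).continuous.comp_aestronglyMeasurable
        ((hσc t ht x).aestronglyMeasurable.prodMk (hymeas t ht))
    · refine (ContinuousLinearMap.le_opNorm _ _).trans ?_
      exact mul_le_mul (hσbd t (hsub t ht) _ (hyB t ht) x x') (hball _ (hyB t ht) x')
        (norm_nonneg _) hCσ
  -- equicontinuity
  have hequi : ∀ ε > (0 : ℝ), ∃ ρ > (0 : ℝ), ∀ t ∈ Set.Icc (0 : ℝ) T'', ∀ x₁ x₂,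
      dist x₁ x₂ ≤ ρ → ‖y t x₁ - y t x₂‖ ≤ ε := by
    intro ε hε
    obtain ⟨η, hη, hηle⟩ : ∃ η > 0, η + (η * M + η) * T'' ≤ ε := by
      have hp : 0 < 1 + (M + 1) * T'' := by positivity
      refine ⟨ε / (1 + (M + 1) * T''), by positivity, le_of_eq ?_⟩
      field_simp
    obtain ⟨ρ1, hρ1, h1⟩ := hσcont η hη
    obtain ⟨ρ2, hρ2, h2⟩ := hfcont η hη
    obtain ⟨ρ3, hρ3, h3⟩ := Metric.uniformContinuous_iff.1
      (CompactSpace.uniformContinuous_of_continuous hy0cont) η hη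
    refine ⟨min (min ρ1 ρ2) (ρ3 / 2), by positivity, fun t ht x₁ x₂ hx => ?_⟩
    have hx1 : dist x₁ x₂ ≤ ρ1 := hx.trans ((min_le_left _ _).trans (min_le_left _ _))
    have hx2 : dist x₁ x₂ ≤ ρ2 := hx.trans ((min_le_left _ _).trans (min_le_right _ _))
    have hx3 : dist x₁ x₂ < ρ3 := by
      have := hx.trans (min_le_right _ _)
      linarith
    have hder : ∀ s ∈ Set.Icc (0 : ℝ) T'', HasDerivWithinAt (fun s => y s x₁ - y s x₂)
        (((∫ x', (σ s (y s) x₁ x') (y s x') ∂ν) + f s (y s) x₁) -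
          ((∫ x', (σ s (y s) x₂ x') (y s x') ∂ν) + f s (y s) x₂)) (Set.Icc 0 T'') s :=
      fun s hs => (hyode x₁ s hs).sub (hyode x₂ s hs)
    have hmv := (convex_Icc (0 : ℝ) T'').norm_image_sub_le_of_norm_hasDerivWithin_le
      (C := η * M + η) hder (by
        intro s hs
        rw [add_sub_add_comm, ← integral_sub (hintegr s hs x₁) (hintegr s hs x₂)]
        refine (norm_add_le _ _).trans (add_le_add ?_ (h2 s (hsub s hs) _ (hyB s hs) _ _ hx2))
        have := norm_integral_le_of_norm_le_const (μ := ν) (C := η * M)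
          (f := fun x' => (σ s (y s) x₁ x') (y s x') - (σ s (y s) x₂ x') (y s x'))
          (Filter.Eventually.of_forall fun x' => by
            rw [← sub_apply]
            refine (ContinuousLinearMap.le_opNorm _ _).trans ?_
            exact mul_le_mul (h1 s (hsub s hs) _ (hyB s hs) _ _ _ _ hx1
              (by simpa using hρ1.le)) (hball _ (hyB s hs) x') (norm_nonneg _) hη.le)
        simpa using this) h0mem ht
    have h4 : ‖y 0 x₁ - y 0 x₂‖ ≤ η := by
      rw [hyinit, ← dist_eq_norm]
      exact (h3 hx3).le
    have h5 : ‖y t x₁ - y t x₂‖ ≤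
        ‖(y t x₁ - y t x₂) - (y 0 x₁ - y 0 x₂)‖ + ‖y 0 x₁ - y 0 x₂‖ := by
      simpa using norm_add_le ((y t x₁ - y t x₂) - (y 0 x₁ - y 0 x₂)) (y 0 x₁ - y 0 x₂)
    have h6 : ‖t - 0‖ ≤ T'' := by
      rw [sub_zero, Real.norm_of_nonneg ht.1]
      exact ht.2
    have h7 : (η * M + η) * ‖t - 0‖ ≤ (η * M + η) * T'' :=
      mul_le_mul_of_nonneg_left h6 (by positivity)
    linarith
  -- main estimate
  have hmain : ∀ δ > (0 : ℝ), ∃ N₁ : ℕ, N₀ ≤ N₁ ∧ ∀ N, N₁ ≤ N →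
      ∀ t ∈ Set.Icc (0 : ℝ) T'', ∀ x, ‖pc (Ωi N) (ξ N t) x - y t x‖ ≤ δ := by
    intro δ hδ
    obtain ⟨K, hKdef⟩ : ∃ K, K = Lσ * M + Cσ + Lf + 1 := ⟨_, rfl⟩
    have hK : 0 < K := by rw [hKdef]; positivity
    obtain ⟨G, hGdef⟩ : ∃ G, G = (M + K) / K * (Real.exp (K * T'') - 1) := ⟨_, rfl⟩
    have hG : 0 ≤ G := by
      have : 1 ≤ Real.exp (K * T'') := Real.one_le_exp (by positivity)
      rw [hGdef]
      exact mul_nonneg (by positivity) (by linarith)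
    obtain ⟨η, hη, hηle⟩ : ∃ η > 0, η + η * G ≤ δ := by
      refine ⟨δ / (1 + G), by positivity, le_of_eq ?_⟩
      field_simp
    obtain ⟨ρ1, hρ1, h1⟩ := hσcont η hη
    obtain ⟨ρ2, hρ2, h2⟩ := hequi η hη
    have hlim : Filter.Tendsto (fun N : ℕ => CΩ / (N : ℝ) ^ γ) Filter.atTop (nhds 0) :=
      ((tendsto_rpow_atTop hγ).comp tendsto_natCast_atTop_atTop).const_div_atTop CΩ
    obtain ⟨N2, hN2⟩ := Filter.eventually_atTop.1
      (hlim.eventually (ge_mem_nhds (lt_min hρ1 hρ2)))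
    refine ⟨max N₀ N2, le_max_left _ _, fun N hN => ?_⟩
    have hNN0 : N₀ ≤ N := (le_max_left _ _).trans hN
    have hN1 : 1 ≤ N := hN₀.trans hNN0
    have hdia : ∀ i, ∀ x ∈ Ωi N i, dist (xi N i) x ≤ min ρ1 ρ2 := fun i x hx =>
      (Metric.dist_le_diam_of_mem (Metric.isBounded_of_compactSpace) (htag N hN1 i) hx).trans
        ((hdiam N hN1 i).trans (hN2 N ((le_max_right _ _).trans hN)))
    have hcov : ∀ x, ∃ i, x ∈ Ωi N i := fun x => by
      have : x ∈ ⋃ i, Ωi N i := by rw [hcover N hN1]; trivial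
      simpa using this
    have hpc : ∀ (a : Fin N → EuclideanSpace ℝ (Fin d)) i x, x ∈ Ωi N i →
        pc (Ωi N) a x = a i := fun a i x hx => pc_eq_of_mem _ _ (hdisj N hN1) hx
    let w : ℝ → Fin N → EuclideanSpace ℝ (Fin d) := fun t i => ξ N t i - y t (xi N i)
    have hptw : ∀ t ∈ Set.Icc (0 : ℝ) T'', ∀ x,
        ‖pc (Ωi N) (ξ N t) x - y t x‖ ≤ η + ‖w t‖ := by
      intro t ht x
      obtain ⟨i, hi⟩ := hcov x
      rw [hpc _ i x hi]
      have e1 : ξ N t i - y t x = (y t (xi N i) - y t x) + w t i := by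
        simp only [w]
        abel
      rw [e1]
      exact (norm_add_le _ _).trans (add_le_add
        (h2 t ht _ _ ((hdia i x hi).trans (min_le_right _ _))) (norm_le_pi_norm _ _))
    let w' : ℝ → Fin N → EuclideanSpace ℝ (Fin d) := fun t i =>
      ((N : ℝ)⁻¹ • ∑ j, (σ t (pc (Ωi N) (ξ N t)) (xi N i) (xi N j)) (ξ N t j)
          + f t (pc (Ωi N) (ξ N t)) (xi N i)) -
        ((∫ x', (σ t (y t) (xi N i) x') (y t x') ∂ν) + f t (y t) (xi N i))
    have hw : ∀ t ∈ Set.Icc (0 : ℝ) T'', HasDerivWithinAt w (w' t) (Set.Icc 0 T'') t := by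
      intro t ht
      rw [hasDerivWithinAt_pi]
      intro i
      exact (hξode N hNN0 i t ht).sub (hyode (xi N i) t ht)
    have hw0 : w 0 = 0 := by
      funext i
      simp [w, hξinit N hNN0, hyinit]
    have hbound : ∀ t ∈ Set.Icc (0 : ℝ) T'', ‖w' t‖ ≤ K * ‖w t‖ + η * (M + K) := by
      intro t ht
      have hwn := norm_nonneg (w t)
      obtain ⟨S, hS⟩ : ∃ S, S = η + ‖w t‖ := ⟨_, rfl⟩
      have hS0 : 0 ≤ S := by linarith
      have hsup : supDist (pc (Ωi N) (ξ N t)) (y t) ≤ S := by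
        rw [hS]
        exact ciSup_le (hptw t ht)
      have hB := hξB N hNN0 t ht
      refine (pi_norm_le_iff_of_nonneg (by positivity)).2 (fun i => ?_)
      have hf1 : ‖f t (pc (Ωi N) (ξ N t)) (xi N i) - f t (y t) (xi N i)‖ ≤ Lf * S :=
        (hflipz t (hsub t ht) _ _ hB (hyB t ht) _).trans
          (mul_le_mul_of_nonneg_left hsup hLf)
      have hI : ‖(N : ℝ)⁻¹ • ∑ j, (σ t (pc (Ωi N) (ξ N t)) (xi N i) (xi N j)) (ξ N t j) -
          ∫ x', (σ t (y t) (xi N i) x') (y t x') ∂ν‖ ≤ (η + Lσ * S) * M + Cσ * S := by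
        rw [← integral_pc ν (Ωi N)
          (fun j => (σ t (pc (Ωi N) (ξ N t)) (xi N i) (xi N j)) (ξ N t j))
          (hmeas N hN1) (hvol N hN1),
          ← integral_sub (integrable_pc ν _ _ (hmeas N hN1)) (hintegr t ht _)]
        have key : ∀ x', ‖pc (Ωi N)
            (fun j => (σ t (pc (Ωi N) (ξ N t)) (xi N i) (xi N j)) (ξ N t j)) x' -
            (σ t (y t) (xi N i) x') (y t x')‖ ≤ (η + Lσ * S) * M + Cσ * S := by
          intro x'
          obtain ⟨j, hj⟩ := hcov x'
          rw [hpc _ j x' hj]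
          have k1 : ‖ξ N t j‖ ≤ M := by
            have := hball _ hB x'
            rwa [hpc _ j x' hj] at this
          have k2 : ‖ξ N t j - y t x'‖ ≤ S := by
            have := hptw t ht x'
            rwa [hpc _ j x' hj, ← hS] at this
          have k3 : ‖σ t (pc (Ωi N) (ξ N t)) (xi N i) (xi N j) - σ t (y t) (xi N i) x'‖
              ≤ η + Lσ * S := by
            refine (norm_sub_le_norm_sub_add_norm_sub _
              (σ t (pc (Ωi N) (ξ N t)) (xi N i) x') _).trans (add_le_add ?_ ?_)
            · exact h1 t (hsub t ht) _ hB _ _ _ _ (by simpa using hρ1.le)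
                ((hdia j x' hj).trans (min_le_left _ _))
            · exact (hσlipz t (hsub t ht) _ _ hB (hyB t ht) _ _).trans
                (mul_le_mul_of_nonneg_left hsup hLσ)
          have e2 : (σ t (pc (Ωi N) (ξ N t)) (xi N i) (xi N j)) (ξ N t j) -
              (σ t (y t) (xi N i) x') (y t x') =
              (σ t (pc (Ωi N) (ξ N t)) (xi N i) (xi N j) - σ t (y t) (xi N i) x') (ξ N t j)
              + (σ t (y t) (xi N i) x') (ξ N t j - y t x') := by
            rw [sub_apply, map_sub]
            abel
          rw [e2]
          refine (norm_add_le _ _).trans (add_le_add ?_ ?_)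
          · exact (ContinuousLinearMap.le_opNorm _ _).trans
              (mul_le_mul k3 k1 (norm_nonneg _) (by positivity))
          · exact (ContinuousLinearMap.le_opNorm _ _).trans
              (mul_le_mul (hσbd t (hsub t ht) _ (hyB t ht) _ _) k2 (norm_nonneg _) hCσ)
        simpa using norm_integral_le_of_norm_le_const (μ := ν)
          (Filter.Eventually.of_forall key)
      have : ‖w' t i‖ ≤ ((η + Lσ * S) * M + Cσ * S) + Lf * S := by
        simp only [w']
        rw [add_sub_add_comm]
        exact (norm_add_le _ _).trans (add_le_add hI hf1)
      refine this.trans ?_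
      have e3 : K * ‖w t‖ + η * (M + K) = η * M + K * S := by rw [hS]; ring
      rw [e3, hKdef]
      nlinarith
    have hgr := norm_le_gronwallBound_of_norm_deriv_right_le (f := w) (f' := w') (δ := 0)
      (K := K) (ε := η * (M + K)) (a := 0) (b := T'')
      (fun t ht => (hw t ht).continuousWithinAt)
      (fun t ht => (hw t ⟨ht.1, ht.2.le⟩).mono_of_mem_nhdsWithin (Icc_mem_nhdsGE_of_mem ht))
      (by rw [hw0, norm_zero]) (fun t ht => hbound t ⟨ht.1, ht.2.le⟩)
    intro t ht x
    refine (hptw t ht x).trans (le_trans (add_le_add_right ?_ η) hηle)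
    refine (hgr t ht).trans ?_
    rw [gronwallBound_of_K_ne_0 hK.ne', sub_zero]
    simp only [zero_mul, zero_add]
    have e5 : η * G = η * (M + K) / K * (Real.exp (K * T'') - 1) := by rw [hGdef]; ring
    rw [e5]
    refine mul_le_mul_of_nonneg_left ?_ (by positivity)
    have := Real.exp_le_exp.2 (mul_le_mul_of_nonneg_left ht.2 hK.le)
    linarith
  refine ⟨?_, hmain, ?_⟩
  · intro t ht
    rw [Metric.continuous_iff]
    intro b ε hε
    obtain ⟨ρ, hρ, h⟩ := hequi (ε / 2) (by linarith)
    refine ⟨ρ, hρ, fun a ha => ?_⟩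
    rw [dist_eq_norm]
    have := h t ht a b ha.le
    linarith
  · intro δ hδ
    obtain ⟨N₁, hN₁, h⟩ := hmain δ hδ
    refine ⟨N₁, hN₁, fun N hN t ht i => ?_⟩
    have hN1 : 1 ≤ N := hN₀.trans (hN₁.trans hN)
    have := h N hN t ht (xi N i)
    rwa [pc_eq_of_mem _ _ (hdisj N hN1) (htag N hN1 i)] at this
end
end

section
/- Let (Ω, d_Ω) be a complete metric space endowed with a probability measure ν. Assume the strengthened Lipschitz condition (Lip) on σ and f, and that y⁰ is Lipschitz continuous on Ω with constant Lip(y⁰). Let y be a solution of the integral evolution equation on [0,T′] with initial datum y⁰ (so y(t) ∈ B for all t ∈ [0,T′]). Then for every t ∈ [0,T′] the function x ↦ y(t,x) is Lipschitz continuous on Ω, with Lipschitz constant at most Lip(y⁰) + t·(Lip(σ)(r + ‖y⁰‖_{L^∞}) + Lip(f)). -/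
open MeasureTheory

noncomputable section

/-- propagation of the Lipschitz regularity of the initial datum by the
integral evolution equation, with quantitative Lipschitz constant
`Lip(y⁰) + t (Lip(σ)(r + ‖y⁰‖_∞) + Lip(f))`. -/
theorem stmt3
    {Ω : Type*} [MetricSpace Ω] [CompleteSpace Ω] [MeasurableSpace Ω] [BorelSpace Ω]
    (ν : Measure Ω) [IsProbabilityMeasure ν]
    {d : ℕ} (hd : 0 < d)
    -- the data of the integral evolution equation
    (T : ℝ) (hT : 0 < T)
    (y0 : Ω → EuclideanSpace ℝ (Fin d)) (r : ℝ) (hr : 0 < r)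
    (σ : ℝ → (Ω → EuclideanSpace ℝ (Fin d)) → Ω → Ω →
      (EuclideanSpace ℝ (Fin d) →L[ℝ] EuclideanSpace ℝ (Fin d)))
    (f : ℝ → (Ω → EuclideanSpace ℝ (Fin d)) → Ω → EuclideanSpace ℝ (Fin d))
    (Cσ Cf Lσ Lf : ℝ) (hLσ : 0 ≤ Lσ) (hLf : 0 ≤ Lf)
    -- boundedness of σ and f on the ball B
    (hσbd : ∀ t ∈ Set.Icc (0 : ℝ) T, ∀ z, (∀ x, ‖z x - y0 x‖ ≤ r) →
      ∀ x x', ‖σ t z x x'‖ ≤ Cσ)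
    (hfbd : ∀ t ∈ Set.Icc (0 : ℝ) T, ∀ z, (∀ x, ‖z x - y0 x‖ ≤ r) →
      ∀ x, ‖f t z x‖ ≤ Cf)
    -- the strengthened Lipschitz condition (Lip)
    (hσlip : ∀ t ∈ Set.Icc (0 : ℝ) T, ∀ z₁ z₂, (∀ x, ‖z₁ x - y0 x‖ ≤ r) →
      (∀ x, ‖z₂ x - y0 x‖ ≤ r) → ∀ x₁ x₂ x₁' x₂',
      ‖σ t z₁ x₁ x₁' - σ t z₂ x₂ x₂'‖ ≤
        Lσ * (supDist z₁ z₂ + dist x₁ x₂ + dist x₁' x₂'))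
    (hflip : ∀ t ∈ Set.Icc (0 : ℝ) T, ∀ z₁ z₂, (∀ x, ‖z₁ x - y0 x‖ ≤ r) →
      (∀ x, ‖z₂ x - y0 x‖ ≤ r) → ∀ x₁ x₂,
      ‖f t z₁ x₁ - f t z₂ x₂‖ ≤ Lf * (supDist z₁ z₂ + dist x₁ x₂))
    -- the initial datum is Lipschitz and (essentially) bounded
    (Ly0 : ℝ) (hy0lip : ∀ x x', ‖y0 x - y0 x'‖ ≤ Ly0 * dist x x')
    (hy0bdd : BddAbove (Set.range fun x => ‖y0 x‖))
    -- the solution y of the integral evolution equation on [0,T']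
    (T' : ℝ) (hT'0 : 0 < T') (hT'T : T' ≤ T)
    (y : ℝ → Ω → EuclideanSpace ℝ (Fin d))
    (hymeas : ∀ t ∈ Set.Icc (0 : ℝ) T', AEStronglyMeasurable (y t) ν)
    (hyB : ∀ t ∈ Set.Icc (0 : ℝ) T', ∀ x, ‖y t x - y0 x‖ ≤ r)
    (hyinit : y 0 = y0)
    (hyode : ∀ x, ∀ t ∈ Set.Icc (0 : ℝ) T',
      HasDerivWithinAt (fun s => y s x)
        ((∫ x', (σ t (y t) x x') (y t x') ∂ν) + f t (y t) x)
        (Set.Icc 0 T') t) :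
    ∀ t ∈ Set.Icc (0 : ℝ) T', ∀ x x',
      ‖y t x - y t x'‖ ≤
        (Ly0 + t * (Lσ * (r + ⨆ x'', ‖y0 x''‖) + Lf)) * dist x x' := by
  have hMy0 : ∀ x, ‖y0 x‖ ≤ ⨆ x'', ‖y0 x''‖ := fun x => le_ciSup hy0bdd x
  set M := ⨆ x'', ‖y0 x''‖ with hM
  have hself : ∀ z : Ω → EuclideanSpace ℝ (Fin d), supDist z z = 0 := by
    intro z
    simp [supDist]
  have hyM : ∀ t ∈ Set.Icc (0 : ℝ) T', ∀ x, ‖y t x‖ ≤ r + M := by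
    intro t ht x
    have h1 := hyB t ht x
    have h2 := hMy0 x
    have h3 : ‖y t x‖ ≤ ‖y t x - y0 x‖ + ‖y0 x‖ := by
      simpa using norm_add_le (y t x - y0 x) (y0 x)
    linarith
  have hsub : ∀ t ∈ Set.Icc (0 : ℝ) T', t ∈ Set.Icc (0 : ℝ) T :=
    fun t ht => ⟨ht.1, ht.2.trans hT'T⟩
  have hint : ∀ t ∈ Set.Icc (0 : ℝ) T', ∀ x,
      Integrable (fun x' => (σ t (y t) x x') (y t x')) ν := by
    intro t ht x
    have hc : Continuous (fun x' => σ t (y t) x x') := by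
      have : LipschitzWith (Real.toNNReal Lσ) (fun x' => σ t (y t) x x') := by
        apply LipschitzWith.of_dist_le_mul
        intro a b
        rw [dist_eq_norm, Real.coe_toNNReal _ hLσ]
        have := hσlip t (hsub t ht) (y t) (y t) (hyB t ht) (hyB t ht) x x a b
        simpa [hself] using this
      exact this.continuous
    have hm : AEStronglyMeasurable (fun x' => (σ t (y t) x x') (y t x')) ν := by
      have h1 : AEStronglyMeasurable (fun x' => σ t (y t) x x') ν :=
        hc.measurable.aestronglyMeasurable
      exact (isBoundedBilinearMap_apply (𝕜 := ℝ) (E := EuclideanSpace ℝ (Fin d))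
        (F := EuclideanSpace ℝ (Fin d))).continuous.comp_aestronglyMeasurable
          (h1.prodMk (hymeas t ht))
    refine Integrable.of_bound hm (Cσ * (r + M)) (Filter.Eventually.of_forall fun x' => ?_)
    have hb := hσbd t (hsub t ht) (y t) (hyB t ht) x x'
    exact (ContinuousLinearMap.le_opNorm _ _).trans
      (mul_le_mul hb (hyM t ht x') (norm_nonneg _) ((norm_nonneg _).trans hb))
  intro t ht x x'
  have key := norm_image_sub_le_of_norm_deriv_le_segment'
    (f := fun s => y s x - y s x') (a := 0) (b := T')
    (C := (Lσ * (r + M) + Lf) * dist x x')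
    (fun s hs => (hyode x s hs).sub (hyode x' s hs)) ?_ t ht
  · have h0 := hy0lip x x'
    simp only [hyinit] at key
    have h3 : ‖y t x - y t x'‖ ≤ ‖y t x - y t x' - (y0 x - y0 x')‖ + ‖y0 x - y0 x'‖ := by
      simpa using norm_add_le (y t x - y t x' - (y0 x - y0 x')) (y0 x - y0 x')
    calc _ ≤ _ := h3
      _ ≤ _ := add_le_add key h0
      _ = _ := by ring
  · intro s hs'
    have hs : s ∈ Set.Icc (0 : ℝ) T' := Set.Ico_subset_Icc_self hs'
    have hf := hflip s (hsub s hs) (y s) (y s) (hyB s hs) (hyB s hs) x x'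
    rw [hself, zero_add] at hf
    have hI : ‖(∫ a, (σ s (y s) x a) (y s a) ∂ν) - ∫ a, (σ s (y s) x' a) (y s a) ∂ν‖
        ≤ Lσ * dist x x' * (r + M) := by
      rw [← integral_sub (hint s hs x) (hint s hs x')]
      have := norm_integral_le_of_norm_le_const (μ := ν)
        (f := fun a => (σ s (y s) x a) (y s a) - (σ s (y s) x' a) (y s a))
        (C := Lσ * dist x x' * (r + M)) (Filter.Eventually.of_forall fun a => ?_)
      · simpa using this
      · have h := hσlip s (hsub s hs) (y s) (y s) (hyB s hs) (hyB s hs) x x' a a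
        rw [hself, zero_add, dist_self, add_zero] at h
        rw [← ContinuousLinearMap.sub_apply]
        exact (ContinuousLinearMap.le_opNorm _ _).trans
          (mul_le_mul h (hyM s hs a) (norm_nonneg _) ((norm_nonneg _).trans h))
    rw [add_sub_add_comm]
    refine (norm_add_le _ _).trans ((add_le_add hI hf).trans (le_of_eq ?_))
    ring
end
end

section
/- Let p ∈ ℕ*, and for each multi-index α with |α| ≤ p let a_α : Ω → ℝ^{d×d} be bounded and continuous. Set A h = ∑_{|α| ≤ p} a_α D^α h, and for ε ∈ (0,1] define A_ε g = η_ε ⋆_Ω (A(η_ε ⋆_Ω g)), where the partial derivatives of η_ε ⋆_Ω g are the restrictions to Ω of the partial derivatives of the smooth function η_ε ⋆ g̃. Then for every g of class C^∞ on ℝⁿ with compact support contained in the interior of Ω, ‖A_ε g − A g‖_{L²(Ω, ℝ^d)} → 0 as ε → 0. -/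
open MeasureTheory

noncomputable section

/-- The rescaled mollifier `η_ε(x) = ε⁻ⁿ η(x/ε)`. -/
def mollifier {n : ℕ} (η : EuclideanSpace ℝ (Fin n) → ℝ) (ε : ℝ) :
    EuclideanSpace ℝ (Fin n) → ℝ :=
  fun x => (ε ^ n)⁻¹ * η (ε⁻¹ • x)

/-- The truncated convolution `(k ⋆_Ω g)(x) = ∫_Ω k(x − x′) g(x′) dx′`. -/
def convOmega {n d : ℕ} (Ωset : Set (EuclideanSpace ℝ (Fin n)))
    (k : EuclideanSpace ℝ (Fin n) → ℝ)
    (g : EuclideanSpace ℝ (Fin n) → EuclideanSpace ℝ (Fin d)) :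
    EuclideanSpace ℝ (Fin n) → EuclideanSpace ℝ (Fin d) :=
  fun x => ∫ x' in Ωset, k (x - x') • g x'

/-- The partial derivative in the `i`-th coordinate direction. -/
def pderiv1 {n : ℕ} {F : Type*} [NormedAddCommGroup F] [NormedSpace ℝ F]
    (i : Fin n) (f : EuclideanSpace ℝ (Fin n) → F) : EuclideanSpace ℝ (Fin n) → F :=
  fun x => fderiv ℝ f x (EuclideanSpace.single i 1)

/-- The multi-index derivative `D^α = ∂_1^{α_1} ⋯ ∂_n^{α_n}`. -/
def Dalpha {n : ℕ} {F : Type*} [NormedAddCommGroup F] [NormedSpace ℝ F]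
    (α : Fin n → ℕ) (f : EuclideanSpace ℝ (Fin n) → F) : EuclideanSpace ℝ (Fin n) → F :=
  Fin.foldr n (fun i g => (pderiv1 i)^[α i] g) f

/-- The finite set of multi-indices `α ∈ ℕⁿ` with `|α| ≤ p`. -/
def multiIndices (n p : ℕ) : Finset (Fin n → ℕ) :=
  (Fintype.piFinset fun _ => Finset.range (p + 1)).filter fun α => ∑ i, α i ≤ p

/-- The differential operator `A h = ∑_{|α| ≤ p} a_α D^α h`. -/
def Aop {n d : ℕ} (p : ℕ)
    (a : (Fin n → ℕ) → EuclideanSpace ℝ (Fin n) →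
      (EuclideanSpace ℝ (Fin d) →L[ℝ] EuclideanSpace ℝ (Fin d)))
    (h : EuclideanSpace ℝ (Fin n) → EuclideanSpace ℝ (Fin d)) :
    EuclideanSpace ℝ (Fin n) → EuclideanSpace ℝ (Fin d) :=
  fun x => ∑ α ∈ multiIndices n p, (a α x) (Dalpha α h x)

open scoped Convolution

theorem mollifier_continuous {n : ℕ} {η : EuclideanSpace ℝ (Fin n) → ℝ}
    (h : Continuous η) (ε : ℝ) : Continuous (mollifier η ε) := by
  unfold mollifier
  fun_prop

theorem mollifier_nonneg {n : ℕ} {η : EuclideanSpace ℝ (Fin n) → ℝ}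
    (h : ∀ x, 0 ≤ η x) {ε : ℝ} (hε : 0 < ε) (x) : 0 ≤ mollifier η ε x := by
  unfold mollifier
  have := h (ε⁻¹ • x)
  positivity

theorem mollifier_support {n : ℕ} {η : EuclideanSpace ℝ (Fin n) → ℝ}
    (h : Function.support η ⊆ Metric.closedBall 0 1) {ε r : ℝ} (hε : 0 < ε) (hr : ε < r) :
    Function.support (mollifier η ε) ⊆ Metric.ball 0 r := by
  intro x hx
  have h1 : η (ε⁻¹ • x) ≠ 0 := fun h0 => hx (by simp [mollifier, h0])
  have h2 := h h1
  rw [mem_closedBall_zero_iff, norm_smul, norm_inv, Real.norm_of_nonneg hε.le,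
    inv_mul_le_iff₀ hε, mul_one] at h2
  rw [mem_ball_zero_iff]
  linarith

theorem mollifier_integral {n : ℕ} {η : EuclideanSpace ℝ (Fin n) → ℝ}
    (h : (∫ x, η x) = 1) {ε : ℝ} (hε : 0 < ε) : (∫ x, mollifier η ε x) = 1 := by
  unfold mollifier
  rw [integral_const_mul, Measure.integral_comp_inv_smul_of_nonneg _ _ hε.le, h]
  simp [hε.ne']

theorem convOmega_eq {n d : ℕ} {Ωset : Set (EuclideanSpace ℝ (Fin n))}
    (k : EuclideanSpace ℝ (Fin n) → ℝ)
    {g : EuclideanSpace ℝ (Fin n) → EuclideanSpace ℝ (Fin d)}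
    (hg : tsupport g ⊆ Ωset) : convOmega Ωset k g = k ⋆ g := by
  ext1 x
  rw [convolution_eq_swap]
  unfold convOmega
  apply setIntegral_eq_integral_of_forall_compl_eq_zero
  intro y hy
  rw [image_eq_zero_of_notMem_tsupport (fun h => hy (hg h)), smul_zero]

/-- `v` is smooth with support in `K` and `u = k ⋆ v`. -/
def ConvRel {n d : ℕ} (K : Set (EuclideanSpace ℝ (Fin n)))
    (k : EuclideanSpace ℝ (Fin n) → ℝ)
    (u v : EuclideanSpace ℝ (Fin n) → EuclideanSpace ℝ (Fin d)) : Prop :=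
  ContDiff ℝ (⊤ : ℕ∞) v ∧ tsupport v ⊆ K ∧ u = k ⋆ v

theorem ConvRel.pderiv1 {n d : ℕ} {K : Set (EuclideanSpace ℝ (Fin n))} (hK : IsCompact K)
    {k : EuclideanSpace ℝ (Fin n) → ℝ} (hk : Continuous k)
    {u v : EuclideanSpace ℝ (Fin n) → EuclideanSpace ℝ (Fin d)} (h : ConvRel K k u v)
    (i : Fin n) : ConvRel K k (pderiv1 i u) (pderiv1 i v) := by
  obtain ⟨h1, h2, rfl⟩ := h
  have hc : HasCompactSupport v := hK.of_isClosed_subset (isClosed_tsupport v) h2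
  have h1' : ContDiff ℝ 1 v := h1.of_le (by exact_mod_cast le_top)
  refine ⟨?_, (tsupport_fderiv_apply_subset ℝ _).trans h2, ?_⟩
  · unfold _root_.pderiv1
    exact (h1.fderiv_right (m := (⊤ : ℕ∞)) (by simp)).clm_apply contDiff_const
  · ext1 x
    unfold _root_.pderiv1
    rw [(hc.hasFDerivAt_convolution_right (ContinuousLinearMap.lsmul ℝ ℝ)
      (hk.locallyIntegrable (μ := volume)) h1' x).fderiv]
    rw [convolution_precompR_apply _ (hk.locallyIntegrable (μ := volume)) (hc.fderiv ℝ)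
      (h1'.continuous_fderiv (by simp))]

theorem ConvRel.Dalpha {n d : ℕ} {K : Set (EuclideanSpace ℝ (Fin n))} (hK : IsCompact K)
    {k : EuclideanSpace ℝ (Fin n) → ℝ} (hk : Continuous k)
    {u v : EuclideanSpace ℝ (Fin n) → EuclideanSpace ℝ (Fin d)} (h : ConvRel K k u v)
    (α : Fin n → ℕ) : ConvRel K k (Dalpha α u) (Dalpha α v) := by
  unfold _root_.Dalpha
  rw [Fin.foldr_eq_finRange_foldr, Fin.foldr_eq_finRange_foldr]
  induction List.finRange n with
  | nil => exact h
  | cons i l ih =>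
    simp only [List.foldr_cons]
    generalize α i = m
    induction m with
    | zero => exact ih
    | succ m ihm =>
      rw [Function.iterate_succ_apply', Function.iterate_succ_apply']
      exact ihm.pderiv1 hK hk i

/-- Uniform convergence of mollifications. -/
theorem mollify_unif {n d : ℕ} {η : EuclideanSpace ℝ (Fin n) → ℝ}
    (hηnn : ∀ x, 0 ≤ η x)
    (hηsupp : Function.support η ⊆ Metric.closedBall 0 1)
    (hηint : (∫ x, η x) = 1)
    {w : EuclideanSpace ℝ (Fin n) → EuclideanSpace ℝ (Fin d)}
    (hw : Continuous w) (hc : HasCompactSupport w) {δ : ℝ} (hδ : 0 < δ) :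
    ∀ᶠ ε in nhdsWithin 0 (Set.Ioc (0 : ℝ) 1), ∀ x, ‖(mollifier η ε ⋆ w) x - w x‖ ≤ δ := by
  obtain ⟨r, hr, hru⟩ := Metric.uniformContinuous_iff.1 (hc.uniformContinuous_of_continuous hw) δ hδ
  have h1 : ∀ᶠ ε in nhdsWithin 0 (Set.Ioc (0 : ℝ) 1), ε < r :=
    nhdsWithin_le_nhds (gt_mem_nhds hr)
  filter_upwards [h1, self_mem_nhdsWithin] with ε h1 h2 x
  rw [← dist_eq_norm]
  exact dist_convolution_le hδ.le (mollifier_support hηsupp h2.1 h1)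
    (mollifier_nonneg hηnn h2.1) (mollifier_integral hηint h2.1) hw.aestronglyMeasurable
    (fun y hy => (hru hy).le)

/-- for `g` smooth with compact support in the interior of `Ω`,
`‖A_ε g − A g‖_{L²(Ω)} → 0` as `ε → 0`, where `A_ε g = η_ε ⋆_Ω (A (η_ε ⋆_Ω g))`. -/
theorem stmt8 {n d : ℕ} (hn : 0 < n) (hd : 0 < d)
    (η : EuclideanSpace ℝ (Fin n) → ℝ)
    (hηsmooth : ContDiff ℝ (⊤ : ℕ∞) η)
    (hηnn : ∀ x, 0 ≤ η x)
    (hηsymm : ∀ x, η (-x) = η x)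
    (hηsupp : Function.support η ⊆ Metric.closedBall 0 1)
    (hηint : (∫ x, η x) = 1)
    (O : Set (EuclideanSpace ℝ (Fin n))) (hO : IsOpen O) (hObd : Bornology.IsBounded O)
    (Ωset : Set (EuclideanSpace ℝ (Fin n))) (hΩ : Ωset = closure O)
    (p : ℕ) (hp : 0 < p)
    (a : (Fin n → ℕ) → EuclideanSpace ℝ (Fin n) →
      (EuclideanSpace ℝ (Fin d) →L[ℝ] EuclideanSpace ℝ (Fin d)))
    (Ca : ℝ)
    (habd : ∀ α ∈ multiIndices n p, ∀ x, ‖a α x‖ ≤ Ca)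
    (hacont : ∀ α ∈ multiIndices n p, Continuous (a α))
    (g : EuclideanSpace ℝ (Fin n) → EuclideanSpace ℝ (Fin d))
    (hgsmooth : ContDiff ℝ (⊤ : ℕ∞) g)
    (hgsupp : HasCompactSupport g)
    (hgΩ : tsupport g ⊆ interior Ωset) :
    Filter.Tendsto
      (fun ε : ℝ => eLpNorm
        (fun x => convOmega Ωset (mollifier η ε)
            (Aop p a (convOmega Ωset (mollifier η ε) g)) x - Aop p a g x)
        2 (volume.restrict Ωset))
      (nhdsWithin 0 (Set.Ioc (0 : ℝ) 1)) (nhds 0) := by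
  have hΩc : IsCompact Ωset := hΩ ▸ hObd.isCompact_closure
  set K := tsupport g with hKdef
  have hK : IsCompact K := hgsupp
  have hKΩ : K ⊆ Ωset := hgΩ.trans interior_subset
  have hηc := hηsmooth.continuous
  have hrel : ∀ ε : ℝ, ∀ α, ConvRel K (mollifier η ε)
      (Dalpha α (convOmega Ωset (mollifier η ε) g)) (Dalpha α g) := fun ε α =>
    ConvRel.Dalpha hK (mollifier_continuous hηc ε) ⟨hgsmooth, subset_rfl, convOmega_eq _ hKΩ⟩ α
  have hDc : ∀ α, Continuous (Dalpha α g) := fun α => (hrel 1 α).1.continuous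
  have hDs : ∀ α, tsupport (Dalpha α g) ⊆ K := fun α => (hrel 1 α).2.1
  have hDcs : ∀ α, HasCompactSupport (Dalpha α g) := fun α =>
    hK.of_isClosed_subset (isClosed_tsupport _) (hDs α)
  have hDεc : ∀ ε α, Continuous (Dalpha α (convOmega Ωset (mollifier η ε) g)) := fun ε α => by
    rw [(hrel ε α).2.2]
    exact (hDcs α).continuous_convolution_right _
      ((mollifier_continuous hηc ε).locallyIntegrable) (hDc α)
  have hwc : Continuous (Aop p a g) := by
    unfold Aop
    exact continuous_finsetSum _ fun α hα => (hacont α hα).clm_apply (hDc α)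
  have hwεc : ∀ ε, Continuous (Aop p a (convOmega Ωset (mollifier η ε) g)) := fun ε => by
    unfold Aop
    exact continuous_finsetSum _ fun α hα => (hacont α hα).clm_apply (hDεc ε α)
  have hws : tsupport (Aop p a g) ⊆ K := by
    refine closure_minimal (fun x hx => ?_) (isClosed_tsupport g)
    by_contra hxK
    refine hx (Finset.sum_eq_zero fun α _ => ?_)
    rw [image_eq_zero_of_notMem_tsupport (fun h => hxK (hDs α h)), map_zero]
  have hwcs : HasCompactSupport (Aop p a g) :=
    hK.of_isClosed_subset (isClosed_tsupport _) hws
  -- uniform convergence of `A h_ε`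
  have hA : ∀ δ > 0, ∀ᶠ ε in nhdsWithin 0 (Set.Ioc (0 : ℝ) 1), ∀ x,
      ‖Aop p a (convOmega Ωset (mollifier η ε) g) x - Aop p a g x‖ ≤ δ := by
    intro δ hδ
    set N : ℝ := ((multiIndices n p).card : ℝ) * (|Ca| + 1) + 1 with hN
    have hNpos : 0 < N := by positivity
    have h1 : ∀ᶠ ε in nhdsWithin 0 (Set.Ioc (0 : ℝ) 1), ∀ α ∈ multiIndices n p, ∀ x,
        ‖(mollifier η ε ⋆ Dalpha α g) x - Dalpha α g x‖ ≤ δ / N :=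
      (Finset.eventually_all _).2 fun α _ =>
        mollify_unif hηnn hηsupp hηint (hDc α) (hDcs α) (div_pos hδ hNpos)
    filter_upwards [h1] with ε h1 x
    unfold Aop
    rw [← Finset.sum_sub_distrib]
    calc _ ≤ ∑ α ∈ multiIndices n p, (|Ca| + 1) * (δ / N) := by
          refine norm_sum_le_of_le _ fun α hα => ?_
          rw [← map_sub, (hrel ε α).2.2]
          refine (ContinuousLinearMap.le_opNorm _ _).trans ?_
          have h2 : ‖a α x‖ ≤ |Ca| + 1 := by
            linarith [habd α hα x, le_abs_self Ca]
          exact mul_le_mul h2 (h1 α hα x) (norm_nonneg _) (by positivity)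
      _ = (N - 1) * (δ / N) := by rw [Finset.sum_const, nsmul_eq_mul, hN]; ring
      _ ≤ N * (δ / N) := by
          have : 0 < δ / N := div_pos hδ hNpos
          nlinarith
      _ = δ := by field_simp
  have hmain : ∀ δ > 0, ∀ᶠ ε in nhdsWithin 0 (Set.Ioc (0 : ℝ) 1), ∀ x,
      ‖convOmega Ωset (mollifier η ε)
        (Aop p a (convOmega Ωset (mollifier η ε) g)) x - Aop p a g x‖ ≤ δ := by
    intro δ hδ
    filter_upwards [hA (δ / 2) (by positivity),
      mollify_unif hηnn hηsupp hηint hwc hwcs (half_pos hδ), self_mem_nhdsWithin]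
      with ε h1 h2 hε x
    have hφc := mollifier_continuous hηc ε
    have hwInt : ∀ w : EuclideanSpace ℝ (Fin n) → EuclideanSpace ℝ (Fin d), Continuous w →
        IntegrableOn (fun y => mollifier η ε (x - y) • w y) Ωset := fun w hw =>
      Continuous.continuousOn (by fun_prop) |>.integrableOn_compact hΩc
    have hφi : Integrable (fun y => mollifier η ε (x - y)) :=
      (integrable_of_integral_eq_one (mollifier_integral hηint hε.1)).comp_sub_left x
    have h3 : ‖convOmega Ωset (mollifier η ε) (Aop p a (convOmega Ωset (mollifier η ε) g)) x
        - convOmega Ωset (mollifier η ε) (Aop p a g) x‖ ≤ δ / 2 := by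
      rw [convOmega, convOmega, ← integral_sub (hwInt _ (hwεc ε)) (hwInt _ hwc)]
      calc _ ≤ ∫ y in Ωset, mollifier η ε (x - y) * (δ / 2) := by
            refine norm_integral_le_of_norm_le (hφi.mul_const _).integrableOn
              (Filter.Eventually.of_forall fun y => ?_)
            rw [← smul_sub, norm_smul, Real.norm_of_nonneg (mollifier_nonneg hηnn hε.1 _)]
            exact mul_le_mul_of_nonneg_left (h1 y) (mollifier_nonneg hηnn hε.1 _)
        _ ≤ ∫ y, mollifier η ε (x - y) * (δ / 2) := by
            refine setIntegral_le_integral (hφi.mul_const _)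
              (Filter.Eventually.of_forall fun y => ?_)
            exact mul_nonneg (mollifier_nonneg hηnn hε.1 _) (by positivity)
        _ = δ / 2 := by
            rw [integral_mul_const, integral_sub_left_eq_self (mollifier η ε) volume x,
              mollifier_integral hηint hε.1, one_mul]
    rw [convOmega_eq _ (hws.trans hKΩ)] at h3
    have := norm_sub_le_norm_sub_add_norm_sub
      (convOmega Ωset (mollifier η ε) (Aop p a (convOmega Ωset (mollifier η ε) g)) x)
      ((mollifier η ε ⋆ Aop p a g) x) (Aop p a g x)
    linarith [h2 x]
  -- from uniform to `L²`
  rw [ENNReal.tendsto_nhds_zero]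
  intro c hc
  set M := (volume.restrict Ωset) Set.univ ^ (2 : ENNReal).toReal⁻¹ with hM
  have hMtop : M ≠ ⊤ := by
    refine ENNReal.rpow_ne_top_of_nonneg (by positivity) ?_
    rw [Measure.restrict_apply_univ]
    exact hΩc.measure_lt_top.ne
  obtain ⟨δ, hδ, hδc⟩ : ∃ δ : ℝ, 0 < δ ∧ M * ENNReal.ofReal δ ≤ c := by
    obtain ⟨q, hq, hqc⟩ := ENNReal.exists_nnreal_pos_mul_lt hMtop hc.ne'
    refine ⟨q, hq, ?_⟩
    rw [ENNReal.ofReal_coe_nnreal, mul_comm]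
    exact hqc.le
  filter_upwards [hmain δ hδ] with ε h
  exact (eLpNorm_le_of_ae_bound (Filter.Eventually.of_forall h)).trans hδc
end
end
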